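/- arXiv:2604.08219 — 2 statements merged into one kernel-verified Lean document; each statement's English description precedes it below -/
import Mathlib

section
/- Let C ∈ ℝ^{n×n} be column-stochastic, π ∈ ℝⁿ with C π = π and 𝟙ᵀ π = 1, and Π := π 𝟙ᵀ. Let S ∈ ℝ^{n×n} be invertible and ρ ∈ (0,1) be such that ‖S(C X − Π X)‖_F ≤ ρ ‖S(X − Π X)‖_F for all X ∈ ℝ^{n×d}. Then for any V, M, M⁺ ∈ ℝ^{n×d}, setting V⁺ := C V + (M⁺ − M), one has ‖S(V⁺ − Π V⁺)‖_F² ≤ ((1 + ρ²)/2) ‖S(V − Π V)‖_F² + (2/(1 − ρ²)) ‖S(I − Π)(M⁺ − M)‖_F². -/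
open Matrix BigOperators

/-- The stationary projection `Π = π 𝟙ᵀ` associated with a column-stochastic matrix. -/
noncomputable def projC {n : ℕ} (π : Fin n → ℝ) : Matrix (Fin n) (Fin n) ℝ :=
  Matrix.vecMulVec π (fun _ => (1 : ℝ))

/-- Frobenius norm of an `n × d` real matrix. -/
noncomputable def frobNorm {n d : ℕ} (X : Matrix (Fin n) (Fin d) ℝ) : ℝ :=
  Real.sqrt (∑ i, ∑ j, (X i j) ^ 2)

theorem frobNorm_sq_aux {n d : ℕ} (X : Matrix (Fin n) (Fin d) ℝ) :
    frobNorm X ^ 2 = ∑ i, ∑ j, (X i j) ^ 2 := by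
  unfold frobNorm
  exact Real.sq_sqrt (Finset.sum_nonneg fun i _ => Finset.sum_nonneg fun j _ => sq_nonneg _)

theorem young_aux (ρ a b : ℝ) (h0 : 0 < ρ) (h1 : ρ < 1) :
    (a + b) ^ 2 ≤ (1 + ρ ^ 2) / (2 * ρ ^ 2) * a ^ 2 + 2 / (1 - ρ ^ 2) * b ^ 2 := by
  have hr : 0 < ρ ^ 2 := by positivity
  have hq : 0 < 1 - ρ ^ 2 := by nlinarith
  have key : (1 + ρ ^ 2) / (2 * ρ ^ 2) * a ^ 2 + 2 / (1 - ρ ^ 2) * b ^ 2 - (a + b) ^ 2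
      = (((1 - ρ ^ 2) * a - 2 * ρ ^ 2 * b) ^ 2 + 2 * ρ ^ 2 * (1 - ρ ^ 2) * b ^ 2)
        / (2 * ρ ^ 2 * (1 - ρ ^ 2)) := by
    field_simp
    ring
  have : 0 ≤ (((1 - ρ ^ 2) * a - 2 * ρ ^ 2 * b) ^ 2 + 2 * ρ ^ 2 * (1 - ρ ^ 2) * b ^ 2)
        / (2 * ρ ^ 2 * (1 - ρ ^ 2)) := by positivity
  linarith

theorem projC_mul_aux {n : ℕ} (C : Matrix (Fin n) (Fin n) ℝ) (hC_col : ∀ j, ∑ i, C i j = 1)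
    (π : Fin n → ℝ) : projC π * C = projC π := by
  ext i j
  simp [projC, Matrix.mul_apply, Matrix.vecMulVec_apply, ← Finset.mul_sum, hC_col]

/-- **One-step momentum tracking error bound.**
Let `C` be column-stochastic with `C π = π`, `𝟙ᵀ π = 1`, `Π := π 𝟙ᵀ`, and let `S` be
invertible and `ρ ∈ (0,1)` with `‖S (C X − Π X)‖_F ≤ ρ ‖S (X − Π X)‖_F` for all `X`.
Then, with `V⁺ := C V + (M⁺ − M)`,
`‖S (V⁺ − Π V⁺)‖_F² ≤ (1+ρ²)/2 ‖S (V − Π V)‖_F² + 2/(1−ρ²) ‖S (I − Π)(M⁺ − M)‖_F²`. -/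
theorem tracking_error_one_step {n d : ℕ} (C : Matrix (Fin n) (Fin n) ℝ)
    (hC_nonneg : ∀ i j, 0 ≤ C i j) (hC_col : ∀ j, ∑ i, C i j = 1)
    (π : Fin n → ℝ) (hπ_stat : C.mulVec π = π) (hπ_sum : ∑ i, π i = 1)
    (S : Matrix (Fin n) (Fin n) ℝ) (hS : IsUnit S)
    (ρ : ℝ) (hρ : ρ ∈ Set.Ioo (0 : ℝ) 1)
    (hcontract : ∀ X : Matrix (Fin n) (Fin d) ℝ,
      frobNorm (S * (C * X - projC π * X)) ≤ ρ * frobNorm (S * (X - projC π * X)))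
    (V M Mp : Matrix (Fin n) (Fin d) ℝ) :
    frobNorm (S * ((C * V + (Mp - M)) - projC π * (C * V + (Mp - M)))) ^ 2 ≤
      (1 + ρ ^ 2) / 2 * frobNorm (S * (V - projC π * V)) ^ 2
        + 2 / (1 - ρ ^ 2) * frobNorm (S * ((1 - projC π) * (Mp - M))) ^ 2 := by
  obtain ⟨h0, h1⟩ := hρ
  have hr : 0 < ρ ^ 2 := by positivity
  have e : S * ((C * V + (Mp - M)) - projC π * (C * V + (Mp - M)))
      = S * (C * V - projC π * V) + S * ((1 - projC π) * (Mp - M)) := by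
    rw [← Matrix.mul_add]
    congr 1
    rw [Matrix.mul_add, ← Matrix.mul_assoc, projC_mul_aux C hC_col π, Matrix.sub_mul,
      Matrix.one_mul]
    abel
  have hc := hcontract V
  rw [e]
  generalize S * (C * V - projC π * V) = A at *
  generalize S * ((1 - projC π) * (Mp - M)) = B at *
  have h2 : frobNorm (A + B) ^ 2 ≤
      (1 + ρ ^ 2) / (2 * ρ ^ 2) * frobNorm A ^ 2 + 2 / (1 - ρ ^ 2) * frobNorm B ^ 2 := by
    simp only [frobNorm_sq_aux, Finset.mul_sum, ← Finset.sum_add_distrib]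
    exact Finset.sum_le_sum fun i _ => Finset.sum_le_sum fun j _ => young_aux ρ _ _ h0 h1
  have h3 : frobNorm A ^ 2 ≤ (ρ * frobNorm (S * (V - projC π * V))) ^ 2 :=
    pow_le_pow_left₀ (Real.sqrt_nonneg _) hc 2
  have h4 := mul_le_mul_of_nonneg_left h3
    (show 0 ≤ (1 + ρ ^ 2) / (2 * ρ ^ 2) by positivity)
  have h5 : (1 + ρ ^ 2) / (2 * ρ ^ 2) * (ρ * frobNorm (S * (V - projC π * V))) ^ 2
      = (1 + ρ ^ 2) / 2 * frobNorm (S * (V - projC π * V)) ^ 2 := by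
    field_simp
  linarith
end

section
/- Let m ≥ 1 and let e : ℕ → ℝ^m be a sequence of componentwise nonnegative vectors, J ∈ ℝ^{m×m}, b, h ∈ ℝ^m, and g : ℕ → ℝ with g_k ≥ 0 for all k, such that the componentwise inequality e_{k+1} ≤ J e_k + b + h g_k holds for all k ≥ 0. Suppose there exist p ∈ ℝ^m with all entries strictly positive and c ∈ ℝ^m with all entries nonnegative such that pᵀ(I − J) ≥ cᵀ componentwise. Then for every T ≥ 1, Σ_{k=0}^{T−1} cᵀ e_k ≤ pᵀ e_0 + T · pᵀ b + (pᵀ h) Σ_{k=0}^{T−1} g_k. -/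
open Matrix BigOperators

/-- **Lyapunov summation for a linear system of error inequalities.**
If componentwise nonnegative vectors `e_k` satisfy `e_{k+1} ≤ J e_k + b + h g_k`
(componentwise) with `g_k ≥ 0`, and there are `p > 0`, `c ≥ 0` (componentwise) with
`pᵀ (I − J) ≥ cᵀ` componentwise, then for every `T ≥ 1`,
`Σ_{k<T} cᵀ e_k ≤ pᵀ e_0 + T pᵀ b + (pᵀ h) Σ_{k<T} g_k`. -/
theorem lyapunov_summation {m : ℕ} (hm : 1 ≤ m)
    (e : ℕ → Fin m → ℝ) (J : Matrix (Fin m) (Fin m) ℝ)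
    (b h : Fin m → ℝ) (g : ℕ → ℝ)
    (he_nonneg : ∀ k i, 0 ≤ e k i) (hg_nonneg : ∀ k, 0 ≤ g k)
    (hrec : ∀ k i, e (k + 1) i ≤ J.mulVec (e k) i + b i + h i * g k)
    (p c : Fin m → ℝ) (hp : ∀ i, 0 < p i) (hc : ∀ i, 0 ≤ c i)
    (hpc : ∀ i, c i ≤ Matrix.vecMul p (1 - J) i)
    (T : ℕ) (hT : 1 ≤ T) :
    ∑ k ∈ Finset.range T, (c ⬝ᵥ e k) ≤
      p ⬝ᵥ e 0 + (T : ℝ) * (p ⬝ᵥ b) + (p ⬝ᵥ h) * ∑ k ∈ Finset.range T, g k := by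
  have step : ∀ k, c ⬝ᵥ e k ≤ p ⬝ᵥ e k - p ⬝ᵥ e (k + 1) + p ⬝ᵥ b + (p ⬝ᵥ h) * g k := by
    intro k
    have h1 : c ⬝ᵥ e k ≤ Matrix.vecMul p (1 - J) ⬝ᵥ e k :=
      Finset.sum_le_sum fun i _ => mul_le_mul_of_nonneg_right (hpc i) (he_nonneg k i)
    have h2 : p ⬝ᵥ e (k + 1) ≤ p ⬝ᵥ (J.mulVec (e k) + b + g k • h) := by
      refine Finset.sum_le_sum fun i _ => mul_le_mul_of_nonneg_left ?_ (hp i).le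
      have := hrec k i
      simp only [Pi.add_apply, Pi.smul_apply, smul_eq_mul]
      linarith
    rw [← Matrix.dotProduct_mulVec, Matrix.sub_mulVec, Matrix.one_mulVec, dotProduct_sub] at h1
    rw [dotProduct_add, dotProduct_add, dotProduct_smul, smul_eq_mul] at h2
    linarith
  have key : ∀ n : ℕ, ∑ k ∈ Finset.range n, (c ⬝ᵥ e k) ≤
      p ⬝ᵥ e 0 - p ⬝ᵥ e n + (n : ℝ) * (p ⬝ᵥ b) + (p ⬝ᵥ h) * ∑ k ∈ Finset.range n, g k := by
    intro n
    induction n with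
    | zero => simp
    | succ n ih =>
      rw [Finset.sum_range_succ, Finset.sum_range_succ]
      have := step n
      push_cast
      linarith
  have hpos : 0 ≤ p ⬝ᵥ e T :=
    Finset.sum_nonneg fun i _ => mul_nonneg (hp i).le (he_nonneg T i)
  linarith [key T]
end
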